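/- Let φ ∈ G, Ψ ∈ H and J ∈ M (with respect to X, Λ, Y, y₀). If for some μ > 0 there is a filtering cover N of X such that sup_{λ∈Λ} inf_{x∈A} (J(x) − μ·φ(Ψ(x,λ))) ≥ inf_{x∈A} sup_{z∈A} (J(x) − μ·φ(Ψ(x,λ_z))) for all A ∈ N, then θ(φ,Ψ,J) ≥ μ. -/

import Mathlib

open Set Filter Topology

noncomputable def ricceriTheta {X Λ Y : Type*} (φ : Y → ℝ) (Ψ : X → Λ → Y)
    (lam : X → Λ) (J : X → ℝ) : ℝ :=
  sInf {r : ℝ | ∃ u x, (∀ z, J u ≤ J z) ∧ lam x ≠ lam u ∧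
    r = (J x - J u) / φ (Ψ x (lam u))}

theorem stmt15 {X Λ Y : Type*} [Nonempty X] [TopologicalSpace Λ]
    [TopologicalSpace Y] (y₀ : Y)
    (φ : Y → ℝ) (hφ_lsc : LowerSemicontinuous φ) (hφ0 : ∀ y, 0 ≤ φ y)
    (hφz : ∀ y, φ y = 0 ↔ y = y₀)
    (hφV : ∀ V ∈ 𝓝 y₀, ∃ c > 0, ∀ y ∉ V, c ≤ φ y)
    (Ψ : X → Λ → Y)
    (hΨc : ∀ x, Continuous (Ψ x)) (hΨi : ∀ x, Function.Injective (Ψ x))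
    (hΨo : ∀ x, IsOpenMap (Ψ x))
    (lam : X → Λ) (hlam : ∀ x, Ψ x (lam x) = y₀)
    (hlamnc : ∃ x x', lam x ≠ lam x')
    (J : X → ℝ) (hJ : ∃ u, ∀ x, J u ≤ J x)
    (μ : ℝ) (hμ : 0 < μ)
    (N : Set (Set X)) (hNne : ∀ A ∈ N, A.Nonempty) (hNcov : ⋃₀ N = univ)
    (hNfil : ∀ A₁ ∈ N, ∀ A₂ ∈ N, ∃ A₃ ∈ N, A₁ ∪ A₂ ⊆ A₃)
    (hge : ∀ A ∈ N,
      (⨅ x : A, ⨆ z : A, ((J x - μ * φ (Ψ x (lam z)) : ℝ) : EReal)) ≤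
      ⨆ l : Λ, ⨅ x : A, ((J x - μ * φ (Ψ x l) : ℝ) : EReal)) :
    μ ≤ ricceriTheta φ Ψ lam J := by
  obtain ⟨u₀, hu₀⟩ := hJ
  have hne : ∃ x, lam x ≠ lam u₀ := by
    by_contra! h
    obtain ⟨x, x', hxx'⟩ := hlamnc
    exact hxx' ((h x).trans (h x').symm)
  obtain ⟨x₀, hx₀⟩ := hne
  refine le_csInf ⟨_, u₀, x₀, hu₀, hx₀, rfl⟩ ?_
  rintro _ ⟨u, x, hu, hxu, rfl⟩
  have hpos : 0 < φ (Ψ x (lam u)) := by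
    refine (hφ0 _).lt_of_ne fun h => hxu ?_
    exact hΨi x ((hlam x).trans ((hφz _).1 h.symm).symm)
  rw [le_div_iff₀ hpos]
  by_contra! hlt
  obtain ⟨c, hc₁, hc₂⟩ := exists_between ((div_lt_iff₀' hμ).2 hlt)
  rw [div_lt_iff₀' hμ] at hc₁
  have hU : {l | c < φ (Ψ x l)} ∈ 𝓝 (lam u) :=
    (hΨc x).continuousAt.eventually (hφ_lsc (Ψ x (lam u)) c hc₂)
  have hV : Ψ u '' {l | c < φ (Ψ x l)} ∈ 𝓝 y₀ := hlam u ▸ (hΨo u).image_mem_nhds hU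
  obtain ⟨d, hd, hdV⟩ := hφV _ hV
  obtain ⟨A, hA, huA, hxA⟩ : ∃ A ∈ N, u ∈ A ∧ x ∈ A := by
    obtain ⟨A₁, h₁, hu₁⟩ := mem_sUnion.1 (hNcov ▸ mem_univ u)
    obtain ⟨A₂, h₂, hx₂⟩ := mem_sUnion.1 (hNcov ▸ mem_univ x)
    obtain ⟨A, hA, hsub⟩ := hNfil A₁ h₁ A₂ h₂
    exact ⟨A, hA, hsub (Or.inl hu₁), hsub (Or.inr hx₂)⟩
  have hinf : ((J u : ℝ) : EReal) ≤
      ⨆ l : Λ, ⨅ x : A, ((J x - μ * φ (Ψ x l) : ℝ) : EReal) := by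
    refine (le_iInf fun z : A => le_iSup_of_le z ?_).trans (hge A hA)
    simpa [hlam, (hφz y₀).2 rfl] using hu z
  have hε : J u - min (μ * d) (μ * c - (J x - J u)) < J u :=
    sub_lt_self _ (lt_min (mul_pos hμ hd) (sub_pos.2 hc₁))
  obtain ⟨l, hl⟩ := lt_iSup_iff.1 ((EReal.coe_lt_coe_iff.2 hε).trans_le hinf)
  have hlu := EReal.coe_lt_coe_iff.1 (hl.trans_le (iInf_le _ ⟨u, huA⟩))
  have hlx := EReal.coe_lt_coe_iff.1 (hl.trans_le (iInf_le _ ⟨x, hxA⟩))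
  have hφd : φ (Ψ u l) < d := by
    refine lt_of_mul_lt_mul_left ?_ hμ.le
    linarith [min_le_left (μ * d) (μ * c - (J x - J u))]
  have hlV : Ψ u l ∈ Ψ u '' {l | c < φ (Ψ x l)} := by
    by_contra h
    exact (hdV _ h).not_gt hφd
  have hlU : c < φ (Ψ x l) := (hΨi u).mem_set_image.1 hlV
  linarith [min_le_right (μ * d) (μ * c - (J x - J u)), mul_lt_mul_of_pos_left hlU hμ]
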